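/- On ℝ² with the Euclidean cometric g, the Poisson bivector Π ∂₁∧∂₂ and the associated contravariant Levi-Civita connection D with curvature R, if a smooth 1-form η is 2-Killing, then for all smooth 1-forms α, β one has g(R(α,η)η, β) + g(R(β,η)η, α) = 2g(D_αη, D_βη) + g(D_αD_ηη, β) + g(D_βD_ηη, α). -/

import Mathlib

noncomputable section

/-- Smooth scalar functions on `ℝ²`. -/
abbrev Fn : Type := (ℝ × ℝ) → ℝ

/-- A 1-form on `ℝ²` identified with its pair of component functions. -/
abbrev OneForm : Type := Fn × Fn

/-- Partial derivative in the first coordinate direction. -/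
def pd1 (f : Fn) : Fn := fun p => fderiv ℝ f p (1, 0)

/-- Partial derivative in the second coordinate direction. -/
def pd2 (f : Fn) : Fn := fun p => fderiv ℝ f p (0, 1)

/-- Smoothness of a function. -/
def SmoothFn (f : Fn) : Prop := ContDiff ℝ (⊤ : ℕ∞) f

/-- Smoothness of a 1-form. -/
def SmoothForm (ω : OneForm) : Prop := SmoothFn ω.1 ∧ SmoothFn ω.2

/-- The Euclidean cometric on 1-forms. -/
def gmet (ω τ : OneForm) : Fn := fun p => ω.1 p * τ.1 p + ω.2 p * τ.2 p

/-- The sharp map `♯(ω)` acting on a function. -/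
def sharpF (Pi : Fn) (ω : OneForm) (f : Fn) : Fn :=
  fun p => Pi p * (ω.1 p * pd2 f p - ω.2 p * pd1 f p)

/-- The contravariant Levi-Civita connection associated with `(g, Π)`. -/
def Dconn (Pi : Fn) (ω τ : OneForm) : OneForm :=
  (fun p => sharpF Pi ω τ.1 p + (ω.1 p * pd1 Pi p + ω.2 p * pd2 Pi p) * τ.2 p,
   fun p => sharpF Pi ω τ.2 p - (ω.1 p * pd1 Pi p + ω.2 p * pd2 Pi p) * τ.1 p)

/-- The sharp map as a vector field `(X¹, X²)`. -/
def sharpVF (Pi : Fn) (ω : OneForm) : Fn × Fn :=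
  (fun p => -(Pi p) * ω.2 p, fun p => Pi p * ω.1 p)

/-- Lie derivative of a 1-form along a vector field. -/
def lieVF (X : Fn × Fn) (τ : OneForm) : OneForm :=
  (fun p => X.1 p * pd1 τ.1 p + X.2 p * pd2 τ.1 p + τ.1 p * pd1 X.1 p + τ.2 p * pd1 X.2 p,
   fun p => X.1 p * pd1 τ.2 p + X.2 p * pd2 τ.2 p + τ.1 p * pd2 X.1 p + τ.2 p * pd2 X.2 p)

/-- The bivector evaluated on two 1-forms: `Π(ω,τ) = Π·(ω₁τ₂ − ω₂τ₁)`. -/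
def PiForm (Pi : Fn) (ω τ : OneForm) : Fn :=
  fun p => Pi p * (ω.1 p * τ.2 p - ω.2 p * τ.1 p)

/-- The exterior differential of a function, as a 1-form. -/
def dF (f : Fn) : OneForm := (pd1 f, pd2 f)

/-- The Koszul bracket of 1-forms. -/
def koszul (Pi : Fn) (ω τ : OneForm) : OneForm :=
  lieVF (sharpVF Pi ω) τ - lieVF (sharpVF Pi τ) ω - dF (PiForm Pi ω τ)

/-- Lie derivative of the cometric `g` along a 1-form `η`. -/
def lieG (Pi : Fn) (η α β : OneForm) : Fn :=
  fun p => sharpF Pi η (gmet α β) p - gmet (koszul Pi η α) β p - gmet α (koszul Pi η β) p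

/-- Second Lie derivative `(L_η (L_η g))(α, β)`. -/
def lie2G (Pi : Fn) (η α β : OneForm) : Fn :=
  fun p => sharpF Pi η (lieG Pi η α β) p - lieG Pi η (koszul Pi η α) β p
    - lieG Pi η α (koszul Pi η β) p

/-- `η` is a Killing 1-form. -/
def IsKilling (Pi : Fn) (η : OneForm) : Prop :=
  ∀ α β : OneForm, SmoothForm α → SmoothForm β → lieG Pi η α β = 0

/-- `η` is a 2-Killing 1-form. -/
def Is2Killing (Pi : Fn) (η : OneForm) : Prop :=
  ∀ α β : OneForm, SmoothForm α → SmoothForm β → lie2G Pi η α β = 0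

/-- Curvature of the contravariant connection. -/
def curv (Pi : Fn) (ω τ γ : OneForm) : OneForm :=
  Dconn Pi ω (Dconn Pi τ γ) - Dconn Pi τ (Dconn Pi ω γ) - Dconn Pi (koszul Pi ω τ) γ

/-- The coordinate 1-form `dx¹`. -/
def dx1 : OneForm := (fun _ => 1, fun _ => 0)

/-- The coordinate 1-form `dx²`. -/
def dx2 : OneForm := (fun _ => 0, fun _ => 1)

/-- Contravariant Laplacian on functions. -/
def lapF (Pi : Fn) (f : Fn) : Fn :=
  fun p => -((sharpF Pi dx1 (sharpF Pi dx1 f) p - sharpF Pi (Dconn Pi dx1 dx1) f p)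
    + (sharpF Pi dx2 (sharpF Pi dx2 f) p - sharpF Pi (Dconn Pi dx2 dx2) f p))

/-- Contravariant Laplacian on 1-forms. -/
def lapO (Pi : Fn) (η : OneForm) : OneForm :=
  -((Dconn Pi dx1 (Dconn Pi dx1 η) - Dconn Pi (Dconn Pi dx1 dx1) η)
    + (Dconn Pi dx2 (Dconn Pi dx2 η) - Dconn Pi (Dconn Pi dx2 dx2) η))

theorem SmoothFn.differentiableAt {f : Fn} (hf : SmoothFn f) (p : ℝ × ℝ) :
    DifferentiableAt ℝ f p :=
  ContDiff.differentiable hf (by simp) p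

theorem SmoothFn.pd1 {f : Fn} (hf : SmoothFn f) : SmoothFn (pd1 f) :=
  (ContDiff.fderiv_right (m := (⊤ : ℕ∞)) hf (by simp)).clm_apply contDiff_const

theorem SmoothFn.pd2 {f : Fn} (hf : SmoothFn f) : SmoothFn (pd2 f) :=
  (ContDiff.fderiv_right (m := (⊤ : ℕ∞)) hf (by simp)).clm_apply contDiff_const

theorem pd1_mul {f g : Fn} (hf : SmoothFn f) (hg : SmoothFn g) (p : ℝ × ℝ) :
    pd1 (fun q => f q * g q) p = pd1 f p * g p + f p * pd1 g p := by
  simp only [pd1, fderiv_fun_mul (hf.differentiableAt p) (hg.differentiableAt p),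
    add_apply, smul_apply, smul_eq_mul]
  ring

theorem pd2_mul {f g : Fn} (hf : SmoothFn f) (hg : SmoothFn g) (p : ℝ × ℝ) :
    pd2 (fun q => f q * g q) p = pd2 f p * g p + f p * pd2 g p := by
  simp only [pd2, fderiv_fun_mul (hf.differentiableAt p) (hg.differentiableAt p),
    add_apply, smul_apply, smul_eq_mul]
  ring

theorem pd1_add {f g : Fn} (hf : SmoothFn f) (hg : SmoothFn g) (p : ℝ × ℝ) :
    pd1 (fun q => f q + g q) p = pd1 f p + pd1 g p := by
  simp [pd1, fderiv_fun_add (hf.differentiableAt p) (hg.differentiableAt p)]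

theorem pd2_add {f g : Fn} (hf : SmoothFn f) (hg : SmoothFn g) (p : ℝ × ℝ) :
    pd2 (fun q => f q + g q) p = pd2 f p + pd2 g p := by
  simp [pd2, fderiv_fun_add (hf.differentiableAt p) (hg.differentiableAt p)]

theorem pd1_neg (f : Fn) (p : ℝ × ℝ) : pd1 (fun q => -f q) p = -pd1 f p := by
  simp [pd1, fderiv_fun_neg]

theorem pd2_neg (f : Fn) (p : ℝ × ℝ) : pd2 (fun q => -f q) p = -pd2 f p := by
  simp [pd2, fderiv_fun_neg]

theorem pd1_sub {f g : Fn} (hf : SmoothFn f) (hg : SmoothFn g) (p : ℝ × ℝ) :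
    pd1 (fun q => f q - g q) p = pd1 f p - pd1 g p := by
  simp [pd1, fderiv_fun_sub (hf.differentiableAt p) (hg.differentiableAt p)]

theorem pd2_sub {f g : Fn} (hf : SmoothFn f) (hg : SmoothFn g) (p : ℝ × ℝ) :
    pd2 (fun q => f q - g q) p = pd2 f p - pd2 g p := by
  simp [pd2, fderiv_fun_sub (hf.differentiableAt p) (hg.differentiableAt p)]

theorem SmoothFn.mul {f g : Fn} (hf : SmoothFn f) (hg : SmoothFn g) :
    SmoothFn (fun q => f q * g q) :=
  ContDiff.mul hf hg

theorem SmoothFn.add {f g : Fn} (hf : SmoothFn f) (hg : SmoothFn g) :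
    SmoothFn (fun q => f q + g q) :=
  ContDiff.add hf hg

theorem SmoothFn.sub {f g : Fn} (hf : SmoothFn f) (hg : SmoothFn g) :
    SmoothFn (fun q => f q - g q) :=
  ContDiff.sub hf hg

theorem SmoothFn.neg {f : Fn} (hf : SmoothFn f) : SmoothFn (fun q => -f q) :=
  ContDiff.neg hf

theorem SmoothFn.sharpF {Pi f : Fn} {ω : OneForm} (hPi : SmoothFn Pi) (hω : SmoothForm ω)
    (hf : SmoothFn f) : SmoothFn (sharpF Pi ω f) :=
  hPi.mul ((hω.1.mul hf.pd2).sub (hω.2.mul hf.pd1))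

theorem SmoothForm.sub {ω τ : OneForm} (hω : SmoothForm ω) (hτ : SmoothForm τ) :
    SmoothForm (ω - τ) :=
  ⟨hω.1.sub hτ.1, hω.2.sub hτ.2⟩

theorem SmoothForm.gmet {ω τ : OneForm} (hω : SmoothForm ω) (hτ : SmoothForm τ) :
    SmoothFn (gmet ω τ) :=
  (hω.1.mul hτ.1).add (hω.2.mul hτ.2)

theorem SmoothForm.Dconn {Pi : Fn} {ω τ : OneForm} (hPi : SmoothFn Pi) (hω : SmoothForm ω)
    (hτ : SmoothForm τ) : SmoothForm (Dconn Pi ω τ) :=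
  have h := (hω.1.mul hPi.pd1).add (hω.2.mul hPi.pd2)
  ⟨(hPi.sharpF hω hτ.1).add (h.mul hτ.2), (hPi.sharpF hω hτ.2).sub (h.mul hτ.1)⟩

theorem sharpF_add {Pi f g : Fn} (ω : OneForm) (hf : SmoothFn f) (hg : SmoothFn g)
    (p : ℝ × ℝ) :
    sharpF Pi ω (fun q => f q + g q) p = sharpF Pi ω f p + sharpF Pi ω g p := by
  simp only [sharpF, pd1_add hf hg, pd2_add hf hg]
  ring

/-- The connection `D` is compatible with the cometric. -/
theorem sharpF_gmet {Pi : Fn} (ω : OneForm) {α β : OneForm} (hα : SmoothForm α)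
    (hβ : SmoothForm β) (p : ℝ × ℝ) :
    sharpF Pi ω (gmet α β) p = gmet (Dconn Pi ω α) β p + gmet α (Dconn Pi ω β) p := by
  unfold gmet
  rw [sharpF_add ω (hα.1.mul hβ.1) (hα.2.mul hβ.2)]
  simp only [sharpF, Dconn, pd1_mul hα.1 hβ.1, pd1_mul hα.2 hβ.2, pd2_mul hα.1 hβ.1,
    pd2_mul hα.2 hβ.2]
  ring

/-- The connection `D` is torsion-free. -/
theorem koszul_eq {Pi : Fn} {ω τ : OneForm} (hPi : SmoothFn Pi) (hω : SmoothForm ω)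
    (hτ : SmoothForm τ) : koszul Pi ω τ = Dconn Pi ω τ - Dconn Pi τ ω := by
  have h₁ := hω.1.mul hτ.2
  have h₂ := hω.2.mul hτ.1
  unfold koszul PiForm
  ext p <;>
  simp only [Dconn, lieVF, sharpVF, dF, sharpF, Prod.fst_sub, Prod.snd_sub,
    _root_.Pi.sub_apply, pd1_mul hPi (h₁.sub h₂), pd2_mul hPi (h₁.sub h₂), pd1_sub h₁ h₂,
    pd2_sub h₁ h₂, pd1_mul hω.1 hτ.2, pd1_mul hω.2 hτ.1, pd2_mul hω.1 hτ.2,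
    pd2_mul hω.2 hτ.1, pd1_mul hPi.neg hω.2, pd2_mul hPi.neg hω.2, pd1_mul hPi hω.1,
    pd2_mul hPi hω.1, pd1_mul hPi.neg hτ.2, pd2_mul hPi.neg hτ.2, pd1_mul hPi hτ.1,
    pd2_mul hPi hτ.1, pd1_neg, pd2_neg] <;>
  ring

theorem Dconn_sub_left (Pi : Fn) (ω τ γ : OneForm) :
    Dconn Pi (ω - τ) γ = Dconn Pi ω γ - Dconn Pi τ γ := by
  ext p <;>
  simp only [Dconn, sharpF, Prod.fst_sub, Prod.snd_sub, _root_.Pi.sub_apply] <;>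
  ring

theorem gmet_sub_left (ω τ γ : OneForm) (p : ℝ × ℝ) :
    gmet (ω - τ) γ p = gmet ω γ p - gmet τ γ p := by
  simp only [gmet, Prod.fst_sub, Prod.snd_sub, _root_.Pi.sub_apply]
  ring

theorem gmet_comm (ω τ : OneForm) (p : ℝ × ℝ) : gmet ω τ p = gmet τ ω p := by
  simp only [gmet]
  ring

theorem lieG_eq {Pi : Fn} {η α β : OneForm} (hPi : SmoothFn Pi) (hη : SmoothForm η)
    (hα : SmoothForm α) (hβ : SmoothForm β) :
    lieG Pi η α β = fun p => gmet (Dconn Pi α η) β p + gmet (Dconn Pi β η) α p := by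
  ext p
  rw [lieG, sharpF_gmet η hα hβ, koszul_eq hPi hη hα, koszul_eq hPi hη hβ,
    gmet_comm α (Dconn Pi η β), gmet_comm α, gmet_sub_left, gmet_sub_left]
  ring

/-- The second Lie derivative of the cometric in terms of `D` and its curvature. -/
theorem lie2G_eq {Pi : Fn} {η α β : OneForm} (hPi : SmoothFn Pi) (hη : SmoothForm η)
    (hα : SmoothForm α) (hβ : SmoothForm β) (p : ℝ × ℝ) :
    lie2G Pi η α β p =
      2 * gmet (Dconn Pi α η) (Dconn Pi β η) p
        + gmet (Dconn Pi α (Dconn Pi η η)) β p + gmet (Dconn Pi β (Dconn Pi η η)) α p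
        - (gmet (curv Pi α η η) β p + gmet (curv Pi β η η) α p) := by
  have hαη := hα.Dconn hPi hη
  have hβη := hβ.Dconn hPi hη
  rw [lie2G, curv, curv, koszul_eq hPi hη hα, koszul_eq hPi hη hβ, koszul_eq hPi hα hη,
    koszul_eq hPi hβ hη, lieG_eq hPi hη hα hβ,
    lieG_eq hPi hη ((hη.Dconn hPi hα).sub hαη) hβ,
    lieG_eq hPi hη hα ((hη.Dconn hPi hβ).sub hβη),
    sharpF_add η (hαη.gmet hβ) (hβη.gmet hα), sharpF_gmet η hαη hβ, sharpF_gmet η hβη hα]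
  simp only [Dconn_sub_left, gmet, Prod.fst_sub, Prod.snd_sub, _root_.Pi.sub_apply]
  ring

theorem two_killing_polarized (Pi : Fn) (hPi : SmoothFn Pi)
    (η : OneForm) (hη : SmoothForm η) (h2K : Is2Killing Pi η) :
    ∀ α β : OneForm, SmoothForm α → SmoothForm β → ∀ p : ℝ × ℝ,
      gmet (curv Pi α η η) β p + gmet (curv Pi β η η) α p
        = 2 * gmet (Dconn Pi α η) (Dconn Pi β η) p
          + gmet (Dconn Pi α (Dconn Pi η η)) β p
          + gmet (Dconn Pi β (Dconn Pi η η)) α p := by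
  intro α β hα hβ p
  have h := congrFun (h2K α β hα hβ) p
  rw [lie2G_eq hPi hη hα hβ] at h
  simp only [_root_.Pi.zero_apply] at h
  linarith

end
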